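/- Let η = Σ_{i∈I} A_i ⊗ B_i be an (m_A·m_B)×(m_A·m_B) Hermitian positive-definite complex matrix, where ⊗ is the Kronecker product, the A_i are m_A×m_A matrices forming a linearly independent family, and the B_i are m_B×m_B matrices. Suppose there exists an m_B×m_B complex matrix O_B which is not a scalar multiple of the identity and satisfies η · (1 ⊗ O_B) = (1 ⊗ O_B)ᴴ · η. Then there exist an invertible m_B×m_B matrix S and an integer k with 0 < k < m_B such that for every i ∈ I the matrix Sᴴ · B_i · S is block-diagonal with respect to the splitting ℂ^{m_B} = ℂᵏ ⊕ ℂ^{m_B−k}, i.e. (Sᴴ B_i S)_{pq} = 0 whenever p ≤ k < q or q ≤ k < p. -/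

import Mathlib

open scoped ComplexOrder Matrix Kronecker

open scoped MatrixOrder in
/-- A matrix that is quasi-Hermitian with respect to a positive definite matrix is diagonalizable
with real eigenvalues. -/
theorem Matrix.PosDef.exists_isUnit_mul_eq_mul_diagonal {n : Type*} [Fintype n] [DecidableEq n]
    {G M : Matrix n n ℂ} (hG : G.PosDef) (h : G * M = Mᴴ * G) :
    ∃ (S : Matrix n n ℂ) (d : n → ℝ), IsUnit S ∧
      M * S = S * Matrix.diagonal (fun i => (d i : ℂ)) := by
  obtain ⟨C, hC, rfl⟩ := CStarAlgebra.isStrictlyPositive_iff_eq_star_mul_self.mp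
    hG.isStrictlyPositive
  obtain ⟨C, rfl⟩ := hC
  obtain ⟨N, hN⟩ : ∃ N : Matrix n n ℂ, N = C * M * (↑C⁻¹ : Matrix n n ℂ) := ⟨_, rfl⟩
  have hCC : (C : Matrix n n ℂ) * (↑C⁻¹ : Matrix n n ℂ) = 1 := C.mul_inv
  have hCC' : (↑C⁻¹ : Matrix n n ℂ) * (C : Matrix n n ℂ) = 1 := C.inv_mul
  have hstar : (↑C⁻¹ : Matrix n n ℂ)ᴴ * (C : Matrix n n ℂ)ᴴ = 1 := by
    rw [← Matrix.conjTranspose_mul, hCC, Matrix.conjTranspose_one]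
  have hNH : N.IsHermitian := by
    rw [Matrix.star_eq_conjTranspose] at h
    calc Nᴴ = (↑C⁻¹ : Matrix n n ℂ)ᴴ * (Mᴴ * ((C : Matrix n n ℂ)ᴴ * C)) * ↑C⁻¹ := by
          rw [hN]
          simp only [Matrix.conjTranspose_mul, Matrix.mul_assoc, hCC, Matrix.mul_one]
      _ = ((↑C⁻¹ : Matrix n n ℂ)ᴴ * (C : Matrix n n ℂ)ᴴ) * (C * M * ↑C⁻¹) := by
          rw [← h]
          simp only [Matrix.mul_assoc]
      _ = N := by rw [hstar, Matrix.one_mul, hN]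
  let U : Matrix n n ℂ := hNH.eigenvectorUnitary
  have hU : IsUnit U := (Unitary.toUnits hNH.eigenvectorUnitary).isUnit
  have hNU : N * U = U * Matrix.diagonal (fun i => (hNH.eigenvalues i : ℂ)) := by
    ext i j
    have := congrFun (hNH.mulVec_eigenvectorBasis j) i
    rw [Matrix.mul_diagonal, Matrix.mul_apply]
    simpa [Matrix.mulVec, dotProduct, U, Matrix.IsHermitian.eigenvectorUnitary_apply,
      mul_comm] using this
  refine ⟨(↑C⁻¹ : Matrix n n ℂ) * U, hNH.eigenvalues, (C⁻¹).isUnit.mul hU, ?_⟩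
  calc M * ((↑C⁻¹ : Matrix n n ℂ) * U)
      = (↑C⁻¹ : Matrix n n ℂ) * C * M * (↑C⁻¹ * U) := by rw [hCC', Matrix.one_mul]
    _ = (↑C⁻¹ : Matrix n n ℂ) * (N * U) := by simp only [hN, Matrix.mul_assoc]
    _ = _ := by rw [hNU, Matrix.mul_assoc]

/-- The coefficients of a tensor with linearly independent left factors are determined. -/
theorem LinearIndependent.eq_of_sum_kronecker_eq {ι l m n p : Type*} [Fintype ι]
    {A : ι → Matrix l m ℂ} (hA : LinearIndependent ℂ A) {X Y : ι → Matrix n p ℂ}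
    (h : ∑ i, A i ⊗ₖ X i = ∑ i, A i ⊗ₖ Y i) (i : ι) : X i = Y i := by
  ext p q
  refine sub_eq_zero.mp (Fintype.linearIndependent_iff.mp hA (fun i => X i p q - Y i p q) ?_ i)
  ext a b
  have := congrFun (congrFun h (a, p)) (b, q)
  simp only [Matrix.sum_apply, Matrix.kronecker_apply] at this
  simp only [Matrix.sum_apply, Matrix.smul_apply, smul_eq_mul, sub_mul, Finset.sum_sub_distrib,
    Matrix.zero_apply]
  simpa only [mul_comm, sub_eq_zero] using this

/-- A nonconstant tuple can be reordered so that its first `k` entries differ from all the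
remaining ones. -/
theorem Fin.exists_perm_forall_ne_of_ne {α : Type*} [LinearOrder α] {m : ℕ} (d : Fin m → α)
    {a b : Fin m} (hab : d a ≠ d b) :
    ∃ (σ : Equiv.Perm (Fin m)) (k : ℕ), 0 < k ∧ k < m ∧
      ∀ p q : Fin m, (p : ℕ) < k → k ≤ (q : ℕ) → d (σ p) ≠ d (σ q) := by
  classical
  have hmono := Tuple.monotone_sort d
  set σ := Tuple.sort d
  let z : Fin m := ⟨0, a.pos⟩
  have hex : ∃ k : ℕ, ∃ hk : k < m, d (σ z) ≠ d (σ ⟨k, hk⟩) := by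
    by_contra! hc
    have key (x : Fin m) : d (σ z) = d x := by simpa using hc (σ.symm x) (σ.symm x).isLt
    exact hab ((key a).symm.trans (key b))
  obtain ⟨hk, hne⟩ := Nat.find_spec hex
  refine ⟨σ, Nat.find hex, Nat.pos_of_ne_zero fun h0 => hne ?_, hk, fun p q hp hq => ?_⟩
  · simp only [h0, z]
  · have hpz : d (σ z) = d (σ p) := by
      by_contra hc
      exact Nat.find_min hex hp ⟨p.isLt, hc⟩
    have h1 : d (σ z) ≤ d (σ ⟨Nat.find hex, hk⟩) := hmono (Fin.mk_le_mk.mpr (Nat.zero_le _))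
    have h2 : d (σ ⟨Nat.find hex, hk⟩) ≤ d (σ q) := hmono hq
    exact hpz ▸ ((lt_of_le_of_ne h1 hne).trans_le h2).ne

/-- Let `η = ∑ i, A i ⊗ₖ B i` be Hermitian positive definite with the family `A`
linearly independent. If there is a matrix `OB`, not a scalar multiple of the identity, such that
`1 ⊗ₖ OB` is quasi-Hermitian with respect to `η`, then the Schmidt operators `B i` are
simultaneously reducible: there are an invertible `S` and `0 < k < mB` such that every
`Sᴴ * B i * S` is block-diagonal for the splitting `ℂ^mB = ℂᵏ ⊕ ℂ^(mB-k)`. -/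
theorem stmt_6 (mA mB : ℕ) (ι : Type) [Fintype ι]
    (A : ι → Matrix (Fin mA) (Fin mA) ℂ) (B : ι → Matrix (Fin mB) (Fin mB) ℂ)
    (hA : LinearIndependent ℂ A)
    (hη : (∑ i, A i ⊗ₖ B i).PosDef)
    (OB : Matrix (Fin mB) (Fin mB) ℂ)
    (hOB : ¬ ∃ c : ℂ, OB = c • (1 : Matrix (Fin mB) (Fin mB) ℂ))
    (hQH : (∑ i, A i ⊗ₖ B i) * ((1 : Matrix (Fin mA) (Fin mA) ℂ) ⊗ₖ OB)
        = ((1 : Matrix (Fin mA) (Fin mA) ℂ) ⊗ₖ OB)ᴴ * (∑ i, A i ⊗ₖ B i)) :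
    ∃ (S : Matrix (Fin mB) (Fin mB) ℂ) (k : ℕ), IsUnit S ∧ 0 < k ∧ k < mB ∧
      ∀ (i : ι) (p q : Fin mB),
        (((p : ℕ) < k ∧ k ≤ (q : ℕ)) ∨ ((q : ℕ) < k ∧ k ≤ (p : ℕ))) →
        (Sᴴ * B i * S) p q = 0 := by
  rcases Nat.eq_zero_or_pos mA with rfl | hmA
  · have : IsEmpty ι := ⟨fun i => hA.ne_zero i (Subsingleton.elim _ _)⟩
    refine ⟨1, 1, isUnit_one, one_pos, ?_, fun i => isEmptyElim i⟩
    by_contra! hle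
    have := Fin.subsingleton_iff_le_one.mpr hle
    rcases isEmpty_or_nonempty (Fin mB) with _ | ⟨⟨x⟩⟩
    · exact hOB ⟨0, Subsingleton.elim _ _⟩
    · refine hOB ⟨OB x x, ?_⟩
      ext i j
      rw [Subsingleton.elim i x, Subsingleton.elim j x]
      simp
  have hB (i : ι) : B i * OB = OBᴴ * B i := by
    refine hA.eq_of_sum_kronecker_eq (X := fun i => B i * OB) (Y := fun i => OBᴴ * B i) ?_ i
    simpa [Matrix.conjTranspose_kronecker, Finset.sum_mul, Finset.mul_sum,
      ← Matrix.mul_kronecker_mul] using hQH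
  let a : Fin mA := ⟨0, hmA⟩
  have hG : (∑ i, A i a a • B i).PosDef := by
    convert hη.submatrix (e := fun x : Fin mB => (a, x)) (Prod.mk_right_injective a) using 1
    ext p q
    simp [Matrix.sum_apply]
  obtain ⟨S, d, hS, hSd⟩ := hG.exists_isUnit_mul_eq_mul_diagonal (M := OB) (by
    simp [Finset.sum_mul, Finset.mul_sum, hB])
  obtain ⟨x, y, hxy⟩ : ∃ x y, d x ≠ d y := by
    by_contra! hc
    obtain ⟨c, hcd⟩ : ∃ c, ∀ x, d x = c := by
      rcases isEmpty_or_nonempty (Fin mB) with _ | ⟨⟨x⟩⟩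
      · exact ⟨0, fun x => isEmptyElim x⟩
      · exact ⟨d x, fun y => hc y x⟩
    refine hOB ⟨c, hS.mul_right_cancel ?_⟩
    rw [hSd]
    ext i j
    simp [hcd, mul_comm]
  have hcomm (i : ι) (p q : Fin mB) (hpq : d p ≠ d q) : (Sᴴ * B i * S) p q = 0 := by
    set D := Matrix.diagonal fun i => (d i : ℂ) with hD
    have hDH : Dᴴ = D := by
      rw [hD, Matrix.diagonal_conjTranspose]
      congr 1
      ext
      simp
    have key : (Sᴴ * B i * S) * D = D * (Sᴴ * B i * S) := by
      calc (Sᴴ * B i * S) * D = Sᴴ * (B i * OB) * S := by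
            simp only [Matrix.mul_assoc, hSd]
        _ = (OB * S)ᴴ * (B i * S) := by
            simp only [hB, Matrix.conjTranspose_mul, Matrix.mul_assoc]
        _ = D * (Sᴴ * B i * S) := by
            simp only [hSd, Matrix.conjTranspose_mul, hDH, Matrix.mul_assoc]
    have hkey := congrFun (congrFun key p) q
    rw [hD, Matrix.mul_diagonal, Matrix.diagonal_mul, mul_comm] at hkey
    by_contra h0
    exact hpq (Complex.ofReal_injective (mul_right_cancel₀ h0 hkey)).symm
  obtain ⟨σ, k, hk0, hkm, hσ⟩ := Fin.exists_perm_forall_ne_of_ne d hxy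
  refine ⟨S.submatrix id σ, k, ?_, hk0, hkm, fun i p q hpq => ?_⟩
  · exact (Matrix.isUnit_submatrix_equiv (e₁ := Equiv.refl _) (e₂ := σ)).mpr hS
  · have : d (σ p) ≠ d (σ q) := hpq.elim (fun h => hσ p q h.1 h.2) fun h => (hσ q p h.1 h.2).symm
    simpa [Matrix.mul_apply] using hcomm i _ _ this
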